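/- arXiv:2203.07513 — 3 statements merged into one kernel-verified Lean document; each statement's English description precedes it below -/
import Mathlib

section
/- Consider a single-stage screening process: a finite nonempty set of groups 𝒳, weights q_X > 0 and u_X > 0, and a minimally effective test τ_X = (τ_{X1}, τ_{X0}) for each X ∈ 𝒳. Let X* ∈ 𝒳 minimize τ_{X1}, and define the Opportunity Ratio policy π*_X = (τ_{X*1}/τ_{X1}, 0) for each X. Then π* satisfies Equal Opportunity with M(τ_X, π*_X) = τ_{X*1} for every X, its precision denominator is positive, and its precision equals (Σ_X q_X) / (Σ_X (q_X + u_X·τ_{X0}/τ_{X1})); in particular π* attains the maximum precision among Equal Opportunity policies. -/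
open Finset

noncomputable def Mval (t p : ℝ × ℝ) : ℝ := t.1 * p.1 + (1 - t.1) * p.2
noncomputable def Nval (t p : ℝ × ℝ) : ℝ := t.2 * p.1 + (1 - t.2) * p.2

/-- An Equal Opportunity level `M` forces a false-positive mass of at least `M τ₀ / τ₁`. -/
theorem ratio_mul_Mval_le_Nval {t p : ℝ × ℝ} (ht : t.2 ≤ t.1) (ht1 : 0 < t.1) (hp : 0 ≤ p.2) :
    t.2 / t.1 * Mval t p ≤ Nval t p := by
  have key : Nval t p - t.2 / t.1 * Mval t p = (t.1 - t.2) * p.2 / t.1 := by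
    unfold Mval Nval
    field_simp
    ring
  have : 0 ≤ (t.1 - t.2) * p.2 / t.1 :=
    div_nonneg (mul_nonneg (sub_nonneg.2 ht) hp) ht1.le
  linarith

theorem Mval_nonneg {t p : ℝ × ℝ} (ht : t.1 ∈ Set.Icc (0 : ℝ) 1) (hp₁ : 0 ≤ p.1)
    (hp₀ : 0 ≤ p.2) : 0 ≤ Mval t p :=
  add_nonneg (mul_nonneg ht.1 hp₁) (mul_nonneg (sub_nonneg.2 ht.2) hp₀)

/-- The Opportunity Ratio policy `π*_X = (τ_{X*1}/τ_{X1}, 0)` satisfies Equal Opportunity, has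
positive precision denominator, achieves precision `(Σ q_X)/(Σ (q_X + u_X τ_{X0}/τ_{X1}))`, and
maximizes precision among Equal Opportunity policies. -/
theorem stmt2 {𝒳 : Type*} [Fintype 𝒳] [Nonempty 𝒳]
    (q u : 𝒳 → ℝ) (τ : 𝒳 → ℝ × ℝ)
    (hq : ∀ x, 0 < q x) (hu : ∀ x, 0 < u x)
    (hτ : ∀ x, (τ x).2 < (τ x).1 ∧ 0 ≤ (τ x).2 ∧ (τ x).1 ≤ 1)
    (Xstar : 𝒳) (hXstar : ∀ x, (τ Xstar).1 ≤ (τ x).1)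
    (πstar : 𝒳 → ℝ × ℝ)
    (hπstar : πstar = fun x => ((τ Xstar).1 / (τ x).1, 0)) :
    (∀ x, Mval (τ x) (πstar x) = (τ Xstar).1) ∧
    (0 < (∑ x, q x * Mval (τ x) (πstar x)) + ∑ x, u x * Nval (τ x) (πstar x)) ∧
    ((∑ x, q x * Mval (τ x) (πstar x)) /
        ((∑ x, q x * Mval (τ x) (πstar x)) + ∑ x, u x * Nval (τ x) (πstar x)) =
      (∑ x, q x) / (∑ x, (q x + u x * ((τ x).2 / (τ x).1)))) ∧
    ∀ (π : 𝒳 → ℝ × ℝ) (M : ℝ),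
      (∀ x, (π x).1 ∈ Set.Icc (0:ℝ) 1 ∧ (π x).2 ∈ Set.Icc (0:ℝ) 1) →
      (∀ x, Mval (τ x) (π x) = M) →
      0 < (∑ x, q x * Mval (τ x) (π x)) + ∑ x, u x * Nval (τ x) (π x) →
      (∑ x, q x * Mval (τ x) (π x)) /
          ((∑ x, q x * Mval (τ x) (π x)) + ∑ x, u x * Nval (τ x) (π x)) ≤
        (∑ x, q x * Mval (τ x) (πstar x)) /
          ((∑ x, q x * Mval (τ x) (πstar x)) + ∑ x, u x * Nval (τ x) (πstar x)) := by
  have hpos : ∀ x, 0 < (τ x).1 := fun x => (hτ x).2.1.trans_lt (hτ x).1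
  have hM : ∀ x, Mval (τ x) (πstar x) = (τ Xstar).1 := fun x => by
    have := (hpos x).ne'
    simp only [hπstar, Mval]
    field_simp
    ring
  have hN : ∀ x, Nval (τ x) (πstar x) = (τ x).2 / (τ x).1 * (τ Xstar).1 := fun x => by
    simp only [hπstar, Nval]
    ring
  set R := ∑ x, u x * ((τ x).2 / (τ x).1) with hR
  have hR0 : 0 ≤ R :=
    sum_nonneg fun x _ => mul_nonneg (hu x).le (div_nonneg (hτ x).2.1 (hpos x).le)
  have hQ : 0 < ∑ x, q x := sum_pos (fun x _ => hq x) univ_nonempty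
  have hNsum : ∑ x, u x * Nval (τ x) (πstar x) = R * (τ Xstar).1 := by
    simp only [hN, hR, sum_mul, mul_assoc]
  have hMsum : ∑ x, q x * Mval (τ x) (πstar x) = (∑ x, q x) * (τ Xstar).1 := by
    simp only [hM, sum_mul]
  have hprec : (∑ x, q x) * (τ Xstar).1 / ((∑ x, q x) * (τ Xstar).1 + R * (τ Xstar).1) =
      (∑ x, q x) / (∑ x, q x + R) := by
    rw [← add_mul, mul_div_mul_right _ _ (hpos Xstar).ne']
  rw [hNsum, hMsum, sum_add_distrib, ← hR, hprec]
  refine ⟨hM, ?_, rfl, fun π M hπ hEO hden => ?_⟩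
  · rw [← add_mul]
    exact mul_pos (by linarith) (hpos Xstar)
  have hM0 : 0 ≤ M := hEO Xstar ▸
    Mval_nonneg ⟨(hpos Xstar).le, (hτ Xstar).2.2⟩ (hπ Xstar).1.1 (hπ Xstar).2.1
  have hRN : R * M ≤ ∑ x, u x * Nval (τ x) (π x) := by
    rw [hR, sum_mul]
    refine sum_le_sum fun x _ => ?_
    rw [mul_assoc, ← hEO x]
    exact mul_le_mul_of_nonneg_left
      (ratio_mul_Mval_le_Nval (hτ x).1.le (hpos x) (hπ x).2.1) (hu x).le
  simp only [hEO, ← sum_mul] at hden ⊢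
  rw [div_le_div_iff₀ hden (by linarith)]
  linarith [mul_le_mul_of_nonneg_left hRN hQ.le]
end

section
/- Consider a k-stage screening process with minimally effective tests. The Opportunity Ratio policy π* satisfies Equal Opportunity with recall(π*) = ∏_{i=1}^k τ^i_{X*1} > 0, its precision denominator is positive, and precision(π*) = ‖q‖₁ / (‖q‖₁ + Σ_{X∈𝒳} u_X · ∏_{i=1}^k (τ^i_{X0}/τ^i_{X1})); in particular π* attains the maximum precision among Equal Opportunity policies. -/
open Finset

/-- True positive rate of group `x` through a `k`-stage pipeline. -/
noncomputable def MX {𝒳 : Type*} {k : ℕ} (τ π : 𝒳 → Fin k → ℝ × ℝ) (x : 𝒳) : ℝ :=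
  ∏ i, Mval (τ x i) (π x i)

/-- False positive rate of group `x` through a `k`-stage pipeline. -/
noncomputable def NX {𝒳 : Type*} {k : ℕ} (τ π : 𝒳 → Fin k → ℝ × ℝ) (x : 𝒳) : ℝ :=
  ∏ i, Nval (τ x i) (π x i)

/-- Precision (interview efficiency) of a policy. -/
noncomputable def prec {𝒳 : Type*} [Fintype 𝒳] {k : ℕ} (q u : 𝒳 → ℝ)
    (τ π : 𝒳 → Fin k → ℝ × ℝ) : ℝ :=
  (∑ x, q x * MX τ π x) / ((∑ x, q x * MX τ π x) + ∑ x, u x * NX τ π x)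

/-- A policy has all its entries in `[0,1]`. -/
def IsPolicy {𝒳 : Type*} {k : ℕ} (π : 𝒳 → Fin k → ℝ × ℝ) : Prop :=
  ∀ x i, (π x i).1 ∈ Set.Icc (0:ℝ) 1 ∧ (π x i).2 ∈ Set.Icc (0:ℝ) 1

/-- All tests are minimally effective: `τ₁ > τ₀ ≥ 0` (and lie in `[0,1]²`). -/
def MinEff {𝒳 : Type*} {k : ℕ} (τ : 𝒳 → Fin k → ℝ × ℝ) : Prop :=
  ∀ x i, (τ x i).2 < (τ x i).1 ∧ 0 ≤ (τ x i).2 ∧ (τ x i).1 ≤ 1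

theorem mul_Mval_le_Nval {t p : ℝ × ℝ} (h : t.2 < t.1) (h0 : 0 ≤ t.2) (hp : 0 ≤ p.2) :
    t.2 / t.1 * Mval t p ≤ Nval t p := by
  have ht : 0 < t.1 := h0.trans_lt h
  rw [div_mul_eq_mul_div, div_le_iff₀ ht]
  unfold Mval Nval
  nlinarith [mul_nonneg (sub_nonneg.2 h.le) hp]

theorem Mval_nonneg_s4 {t p : ℝ × ℝ} (h0 : 0 ≤ t.1) (h1 : t.1 ≤ 1) (hp1 : 0 ≤ p.1)
    (hp2 : 0 ≤ p.2) : 0 ≤ Mval t p :=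
  add_nonneg (mul_nonneg h0 hp1) (mul_nonneg (sub_nonneg.2 h1) hp2)

theorem MinEff.fst_pos {𝒳 : Type*} {k : ℕ} {τ : 𝒳 → Fin k → ℝ × ℝ} (hτ : MinEff τ)
    (x : 𝒳) (i : Fin k) : 0 < (τ x i).1 :=
  (hτ x i).2.1.trans_lt (hτ x i).1

/-- The false positive rate is at least the true positive rate times the product of the
likelihood ratios of the tests. -/
theorem prod_div_mul_MX_le_NX {𝒳 : Type*} {k : ℕ} {τ π : 𝒳 → Fin k → ℝ × ℝ}
    (hτ : MinEff τ) (hπ : IsPolicy π) (x : 𝒳) :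
    (∏ i, (τ x i).2 / (τ x i).1) * MX τ π x ≤ NX τ π x := by
  unfold MX NX
  rw [← prod_mul_distrib]
  refine prod_le_prod (fun i _ => ?_) fun i _ =>
    mul_Mval_le_Nval (hτ x i).1 (hτ x i).2.1 (hπ x i).2.1
  exact mul_nonneg (div_nonneg (hτ x i).2.1 (hτ.fst_pos x i).le)
    (Mval_nonneg_s4 (hτ.fst_pos x i).le (hτ x i).2.2 (hπ x i).1.1 (hπ x i).2.1)

/-- The Opportunity Ratio policy for a `k`-stage screening process satisfies Equal Opportunity
with recall `∏_i τ^i_{X*1} > 0`, has positive precision denominator, achieves precision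
`‖q‖₁/(‖q‖₁ + Σ_X u_X ∏_i (τ^i_{X0}/τ^i_{X1}))`, and maximizes precision among Equal
Opportunity policies. -/
theorem stmt4 {𝒳 : Type*} [Fintype 𝒳] [Nonempty 𝒳] {k : ℕ} (hk : 0 < k)
    (q u : 𝒳 → ℝ) (τ : 𝒳 → Fin k → ℝ × ℝ)
    (hq : ∀ x, 0 < q x) (hu : ∀ x, 0 < u x) (hτ : MinEff τ)
    (Xstar : 𝒳) (hXstar : ∀ x, (∏ i, (τ Xstar i).1) ≤ ∏ i, (τ x i).1)
    (πstar : 𝒳 → Fin k → ℝ × ℝ)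
    (hπstar : πstar = fun x i =>
      if i = (⟨0, hk⟩ : Fin k) then ((∏ j, (τ Xstar j).1) / ∏ j, (τ x j).1, (0:ℝ))
      else (1, 0)) :
    (∀ x, MX τ πstar x = ∏ i, (τ Xstar i).1) ∧
    (0 < ∏ i, (τ Xstar i).1) ∧
    (0 < (∑ x, q x * MX τ πstar x) + ∑ x, u x * NX τ πstar x) ∧
    (prec q u τ πstar =
      (∑ x, q x) / ((∑ x, q x) + ∑ x, u x * ∏ i, (τ x i).2 / (τ x i).1)) ∧
    ∀ (π : 𝒳 → Fin k → ℝ × ℝ) (M : ℝ), IsPolicy π → (∀ x, MX τ π x = M) →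
      0 < (∑ x, q x * MX τ π x) + ∑ x, u x * NX τ π x →
      prec q u τ π ≤ prec q u τ πstar := by
  have hpos : ∀ x, 0 < ∏ i, (τ x i).1 := fun x => prod_pos fun i _ => hτ.fst_pos x i
  have hM : ∀ x, MX τ πstar x = ∏ i, (τ Xstar i).1 := by
    intro x
    have hval : ∀ i, Mval (τ x i) (πstar x i) = (τ x i).1 *
        if i = ⟨0, hk⟩ then (∏ j, (τ Xstar j).1) / ∏ j, (τ x j).1 else 1 := by
      intro i
      rw [hπstar]
      by_cases h : i = ⟨0, hk⟩ <;> simp [Mval, h]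
    simp only [MX, hval, prod_mul_distrib, prod_ite_eq', mem_univ, if_true]
    exact mul_div_cancel₀ _ (hpos x).ne'
  have hN : ∀ x, NX τ πstar x =
      (∏ i, (τ Xstar i).1) * ∏ i, (τ x i).2 / (τ x i).1 := by
    intro x
    have hval : ∀ i, Nval (τ x i) (πstar x i) = (τ x i).2 *
        if i = ⟨0, hk⟩ then (∏ j, (τ Xstar j).1) / ∏ j, (τ x j).1 else 1 := by
      intro i
      rw [hπstar]
      by_cases h : i = ⟨0, hk⟩ <;> simp [Nval, h]
    simp only [NX, hval, prod_mul_distrib, prod_ite_eq', mem_univ, if_true, prod_div_distrib]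
    ring
  have hS : 0 < ∑ x, q x := sum_pos (fun x _ => hq x) univ_nonempty
  have hR : 0 ≤ ∑ x, u x * ∏ i, (τ x i).2 / (τ x i).1 :=
    sum_nonneg fun x _ => mul_nonneg (hu x).le
      (prod_nonneg fun i _ => div_nonneg (hτ x i).2.1 (hτ.fst_pos x i).le)
  have hsumM : ∑ x, q x * MX τ πstar x = (∏ i, (τ Xstar i).1) * ∑ x, q x := by
    rw [mul_comm, sum_mul]; simp only [hM]
  have hsumN : ∑ x, u x * NX τ πstar x =
      (∏ i, (τ Xstar i).1) * ∑ x, u x * ∏ i, (τ x i).2 / (τ x i).1 := by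
    simp only [hN, mul_sum, mul_left_comm]
  have hprec : prec q u τ πstar =
      (∑ x, q x) / ((∑ x, q x) + ∑ x, u x * ∏ i, (τ x i).2 / (τ x i).1) := by
    rw [prec, hsumM, hsumN, ← mul_add, mul_div_mul_left _ _ (hpos Xstar).ne']
  refine ⟨hM, hpos Xstar, ?_, hprec, ?_⟩
  · rw [hsumM, hsumN, ← mul_add]
    exact mul_pos (hpos Xstar) (by linarith)
  · intro π M hπ hMπ hden
    have hqM : ∑ x, q x * MX τ π x = M * ∑ x, q x := by
      rw [mul_comm, sum_mul]; simp only [hMπ]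
    have huN : M * ∑ x, u x * ∏ i, (τ x i).2 / (τ x i).1 ≤ ∑ x, u x * NX τ π x := by
      rw [mul_sum]
      refine sum_le_sum fun x _ => ?_
      have h := prod_div_mul_MX_le_NX hτ hπ x
      rw [hMπ] at h
      calc _ = u x * ((∏ i, (τ x i).2 / (τ x i).1) * M) := by ring
        _ ≤ _ := mul_le_mul_of_nonneg_left h (hu x).le
    rw [hprec, prec, div_le_div_iff₀ hden (by linarith), hqM]
    nlinarith [mul_le_mul_of_nonneg_left huN hS.le]
end

section
/- Consider a k-stage screening process with minimally effective tests and let π be any Equal Opportunity policy with recall(π) > 0. Then there exists an Equal Opportunity policy π' satisfying (1 − π'^i_{X1})·π'^i_{X0} = 0 for every X ∈ 𝒳 and i ∈ {1,…,k}, such that for each group X ∈ 𝒳 there is at most one stage i with 0 < π'^i_{X0} < 1, and with recall(π') ≥ recall(π) and precision(π') ≥ precision(π). -/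
open Finset

/-- A pair of promotion probabilities `(π₁, π₀)` in `[0,1]²` with `(1 − π₁)π₀ = 0`. -/
def IsCanonicalStage (p : ℝ × ℝ) : Prop :=
  (p.1 ∈ Set.Icc (0:ℝ) 1 ∧ p.2 ∈ Set.Icc (0:ℝ) 1) ∧ (1 - p.1) * p.2 = 0

theorem Nval_nonneg {t p : ℝ × ℝ} (h0 : 0 ≤ t.2) (h1 : t.2 ≤ 1)
    (hp : p.1 ∈ Set.Icc (0:ℝ) 1 ∧ p.2 ∈ Set.Icc (0:ℝ) 1) : 0 ≤ Nval t p := by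
  obtain ⟨⟨hp1, -⟩, hp2, -⟩ := hp
  have : 0 ≤ 1 - t.2 := by linarith
  unfold Nval
  positivity

/-- Every stage can be made canonical without changing the true positive rate or increasing the
false positive rate. -/
theorem exists_isCanonicalStage {t p : ℝ × ℝ} (ht : t.2 < t.1 ∧ 0 ≤ t.2 ∧ t.1 ≤ 1)
    (hp : p.1 ∈ Set.Icc (0:ℝ) 1 ∧ p.2 ∈ Set.Icc (0:ℝ) 1) :
    ∃ p', IsCanonicalStage p' ∧ Mval t p' = Mval t p ∧ Nval t p' ≤ Nval t p := by
  obtain ⟨t1, t0⟩ := t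
  obtain ⟨p1, p0⟩ := p
  obtain ⟨⟨h1, h2⟩, h3, h4⟩ := hp
  obtain ⟨h5, h6, h7⟩ := ht
  simp only [Mval, Nval] at *
  have ht1 : 0 < t1 := by linarith
  have ht0 : 0 ≤ 1 - t0 := by linarith
  have ht1' : 0 ≤ 1 - t1 := by linarith
  rcases le_or_gt (t1 * p1 + (1 - t1) * p0) t1 with h | h
  · refine ⟨((t1 * p1 + (1 - t1) * p0) / t1, 0), ⟨⟨⟨by positivity, ?_⟩, by simp⟩, by simp⟩, ?_, ?_⟩
    · simpa using (div_le_one ht1).2 h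
    · field_simp
      ring
    · simp only [mul_zero, add_zero]
      rw [← mul_div_assoc, div_le_iff₀ ht1]
      nlinarith [mul_nonneg h3 (sub_nonneg.2 h5.le)]
  · have hlt : 0 < 1 - t1 := by nlinarith
    refine ⟨(1, (t1 * p1 + (1 - t1) * p0 - t1) / (1 - t1)),
      ⟨⟨by simp, div_nonneg (by linarith) hlt.le, ?_⟩, by simp⟩, ?_, ?_⟩
    · refine (div_le_one hlt).2 ?_
      nlinarith
    · field_simp
      ring
    · have : (1 - t0) * ((t1 * p1 + (1 - t1) * p0 - t1) / (1 - t1)) ≤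
          t0 * p1 + (1 - t0) * p0 - t0 := by
        rw [← mul_div_assoc, div_le_iff₀ hlt]
        nlinarith [mul_nonneg (sub_nonneg.2 h2) (sub_nonneg.2 h5.le)]
      linarith

theorem Nval_one_mul (t : ℝ × ℝ) (s : ℝ) :
    Nval t (1, s) * (1 - t.1) = (1 - t.2) * Mval t (1, s) - (t.1 - t.2) := by
  simp only [Mval, Nval]
  ring

theorem Mval_one_div {t : ℝ × ℝ} (ht : t.1 < 1) (m : ℝ) :
    Mval t (1, (m - t.1) / (1 - t.1)) = m := by
  have : 1 - t.1 ≠ 0 := by linarith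
  simp only [Mval]
  field_simp
  ring

/-- With a fixed product `m * n`, the expression `A * m + B * n` increases when `m` grows away
from a point where `B * n ≤ A * m`. -/
theorem mul_add_mul_le_of_mul_eq {A B m n m' n' : ℝ} (hB : 0 ≤ B) (hm : 0 < m)
    (hmm : m ≤ m') (hnn : n' ≤ n) (h : m' * n' = m * n) (hAB : B * n ≤ A * m) :
    A * m + B * n ≤ A * m' + B * n' := by
  have h1 : B * n' * (m' - m) ≤ B * n * (m' - m) := by
    have := sub_nonneg.2 hmm
    gcongr
  have h2 : B * n * (m' - m) ≤ A * m * (m' - m) :=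
    mul_le_mul_of_nonneg_right hAB (sub_nonneg.2 hmm)
  have h3 : m * (B * (n - n')) = B * n' * (m' - m) := by linear_combination -B * h
  have h4 : m * (B * (n - n')) ≤ m * (A * (m' - m)) := by linarith
  have := le_of_mul_le_mul_left h4 hm
  linarith

/-- Two partially random stages, one-sided version: the first stage becomes more permissive. -/
theorem exists_extreme_pair_of_le {t w : ℝ × ℝ} {a b : ℝ}
    (ht : t.2 < t.1 ∧ 0 ≤ t.2) (hw : w.2 < w.1 ∧ 0 ≤ w.2) (ht1 : t.1 < 1) (hw1 : w.1 < 1)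
    (ha : a ∈ Set.Icc (0:ℝ) 1) (hb : b ∈ Set.Icc (0:ℝ) 1)
    (h : (1 - w.2) * (t.1 - t.2) * Mval w (1, b) ≤ (1 - t.2) * (w.1 - w.2) * Mval t (1, a)) :
    ∃ a' b' : ℝ, a' ∈ Set.Icc (0:ℝ) 1 ∧ b' ∈ Set.Icc (0:ℝ) 1 ∧
      Mval t (1, a') * Mval w (1, b') = Mval t (1, a) * Mval w (1, b) ∧
      Nval t (1, a') * Nval w (1, b') ≤ Nval t (1, a) * Nval w (1, b) ∧
      (a' = 1 ∨ b' = 0) := by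
  have hta : t.1 ≤ Mval t (1, a) ∧ Mval t (1, a) ≤ 1 := by
    simp only [Mval]; constructor <;> nlinarith [ha.1, ha.2]
  have hwb : w.1 ≤ Mval w (1, b) ∧ Mval w (1, b) ≤ 1 := by
    simp only [Mval]; constructor <;> nlinarith [hb.1, hb.2]
  have htp : 0 < t.1 := by linarith
  have hwp : 0 < w.1 := by linarith
  have key : ∀ m' n' : ℝ, Mval t (1, a) ≤ m' → m' ≤ 1 → w.1 ≤ n' → n' ≤ Mval w (1, b) →
      m' * n' = Mval t (1, a) * Mval w (1, b) → (m' = 1 ∨ n' = w.1) →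
      ∃ a' b' : ℝ, a' ∈ Set.Icc (0:ℝ) 1 ∧ b' ∈ Set.Icc (0:ℝ) 1 ∧
      Mval t (1, a') * Mval w (1, b') = Mval t (1, a) * Mval w (1, b) ∧
      Nval t (1, a') * Nval w (1, b') ≤ Nval t (1, a) * Nval w (1, b) ∧
      (a' = 1 ∨ b' = 0) := by
    intro m' n' h1 h2 h3 h4 h5 h6
    have hd1 : 0 < 1 - t.1 := by linarith
    have hd2 : 0 < 1 - w.1 := by linarith
    refine ⟨(m' - t.1) / (1 - t.1), (n' - w.1) / (1 - w.1),
      ⟨div_nonneg (by linarith) hd1.le, (div_le_one hd1).2 (by linarith)⟩,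
      ⟨div_nonneg (by linarith) hd2.le, (div_le_one hd2).2 (by linarith)⟩, ?_, ?_, ?_⟩
    · rw [Mval_one_div ht1, Mval_one_div hw1, h5]
    · refine le_of_mul_le_mul_right ?_ (mul_pos hd1 hd2)
      have e : ∀ x y : ℝ, Nval t (1, x) * Nval w (1, y) * ((1 - t.1) * (1 - w.1)) =
          ((1 - t.2) * Mval t (1, x) - (t.1 - t.2)) *
            ((1 - w.2) * Mval w (1, y) - (w.1 - w.2)) := by
        intro x y
        rw [← Nval_one_mul, ← Nval_one_mul]
        ring
      rw [e, e, Mval_one_div ht1, Mval_one_div hw1]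
      have := mul_add_mul_le_of_mul_eq (mul_nonneg (by linarith) (by linarith))
        (htp.trans_le hta.1) h1 h4 h5 h
      linear_combination this + (1 - t.2) * (1 - w.2) * h5
    · rcases h6 with rfl | rfl
      · exact Or.inl (div_self hd1.ne')
      · exact Or.inr (by simp)
  have hc := mul_le_mul_of_nonneg_right hta.2 (hwp.trans_le hwb.1).le
  rcases le_total w.1 (Mval t (1, a) * Mval w (1, b)) with hle | hle
  · exact key 1 _ hta.2 le_rfl hle (by linarith) (one_mul _) (Or.inl rfl)
  · refine key (Mval t (1, a) * Mval w (1, b) / w.1) w.1 ?_ ?_ le_rfl hwb.1 ?_ (Or.inr rfl)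
    · rw [le_div_iff₀ hwp]
      exact mul_le_mul_of_nonneg_left hwb.1 (htp.trans_le hta.1).le
    · exact (div_le_one hwp).2 hle
    · field_simp

/-- Of two partially random stages, one can be made deterministic. -/
theorem exists_extreme_pair {t w : ℝ × ℝ} {a b : ℝ}
    (ht : t.2 < t.1 ∧ 0 ≤ t.2 ∧ t.1 ≤ 1) (hw : w.2 < w.1 ∧ 0 ≤ w.2 ∧ w.1 ≤ 1)
    (ha : a ∈ Set.Icc (0:ℝ) 1) (hb : b ∈ Set.Icc (0:ℝ) 1) :
    ∃ a' b' : ℝ, a' ∈ Set.Icc (0:ℝ) 1 ∧ b' ∈ Set.Icc (0:ℝ) 1 ∧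
      Mval t (1, a') * Mval w (1, b') = Mval t (1, a) * Mval w (1, b) ∧
      Nval t (1, a') * Nval w (1, b') ≤ Nval t (1, a) * Nval w (1, b) ∧
      (¬ (0 < a' ∧ a' < 1) ∨ ¬ (0 < b' ∧ b' < 1)) := by
  have hz : (0:ℝ) ∈ Set.Icc (0:ℝ) 1 := by simp
  have ho : (1:ℝ) ∈ Set.Icc (0:ℝ) 1 := by simp
  have mono : ∀ {v : ℝ × ℝ} {c : ℝ}, v.2 < v.1 ∧ 0 ≤ v.2 ∧ v.1 ≤ 1 → c ∈ Set.Icc (0:ℝ) 1 →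
      Nval v (1, 0) ≤ Nval v (1, c) := by
    intro v c hv hc
    simp only [Nval]
    nlinarith [hc.1, hv.1, hv.2.2]
  have hNt := Nval_nonneg (p := (1, a)) ht.2.1 (by linarith) ⟨ho, ha⟩
  have hNw := Nval_nonneg (p := (1, b)) hw.2.1 (by linarith) ⟨ho, hb⟩
  rcases ht.2.2.eq_or_lt with h1 | h1
  · exact ⟨0, b, hz, hb, by simp [Mval, h1], mul_le_mul_of_nonneg_right (mono ht ha) hNw,
      Or.inl (by simp)⟩
  rcases hw.2.2.eq_or_lt with h2 | h2
  · exact ⟨a, 0, ha, hz, by simp [Mval, h2], mul_le_mul_of_nonneg_left (mono hw hb) hNt,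
      Or.inr (by simp)⟩
  rcases le_total ((1 - w.2) * (t.1 - t.2) * Mval w (1, b))
    ((1 - t.2) * (w.1 - w.2) * Mval t (1, a)) with h | h
  · obtain ⟨a', b', ha', hb', hM, hN, h'⟩ :=
      exists_extreme_pair_of_le ⟨ht.1, ht.2.1⟩ ⟨hw.1, hw.2.1⟩ h1 h2 ha hb h
    exact ⟨a', b', ha', hb', hM, hN, by rcases h' with rfl | rfl <;> simp⟩
  · obtain ⟨b', a', hb', ha', hM, hN, h'⟩ :=
      exists_extreme_pair_of_le ⟨hw.1, hw.2.1⟩ ⟨ht.1, ht.2.1⟩ h2 h1 hb ha h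
    exact ⟨a', b', ha', hb', by linarith, by linarith, by rcases h' with rfl | rfl <;> simp⟩

theorem prod_eq_mul_mul_prod_erase {ι : Type*} [Fintype ι] [DecidableEq ι] (f : ι → ℝ) {i j : ι}
    (hij : i ≠ j) : ∏ l, f l = f i * f j * ∏ l ∈ (univ.erase i).erase j, f l := by
  rw [← mul_prod_erase univ f (mem_univ i),
    ← mul_prod_erase (univ.erase i) f (mem_erase.2 ⟨hij.symm, mem_univ j⟩), mul_assoc]

/-- Within one group, a canonical policy can be modified so that at most one stage is partially
random, keeping the true positive rate and not increasing the false positive rate. -/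
theorem exists_subsingleton_random {ι : Type*} [Fintype ι] (t : ι → ℝ × ℝ)
    (ht : ∀ i, (t i).2 < (t i).1 ∧ 0 ≤ (t i).2 ∧ (t i).1 ≤ 1)
    (p : ι → ℝ × ℝ) (hp : ∀ i, IsCanonicalStage (p i)) :
    ∃ p' : ι → ℝ × ℝ, (∀ i, IsCanonicalStage (p' i)) ∧
      (∀ i j, (0 < (p' i).2 ∧ (p' i).2 < 1) → (0 < (p' j).2 ∧ (p' j).2 < 1) → i = j) ∧
      ∏ i, Mval (t i) (p' i) = ∏ i, Mval (t i) (p i) ∧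
      ∏ i, Nval (t i) (p' i) ≤ ∏ i, Nval (t i) (p i) := by
  classical
  induction hn : #{i | 0 < (p i).2 ∧ (p i).2 < 1} using Nat.strong_induction_on generalizing p with
  | _ n ih =>
  subst hn
  by_cases hsub : ∀ i j, (0 < (p i).2 ∧ (p i).2 < 1) → (0 < (p j).2 ∧ (p j).2 < 1) → i = j
  · exact ⟨p, hp, hsub, rfl, le_rfl⟩
  push Not at hsub
  obtain ⟨i, j, hi, hj, hij⟩ := hsub
  have one : ∀ l, 0 < (p l).2 → p l = (1, (p l).2) := by
    intro l hl
    have := (mul_eq_zero.1 (hp l).2).resolve_right hl.ne'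
    exact Prod.ext (by simp only; linarith) rfl
  obtain ⟨a, b, ha, hb, hM, hN, hab⟩ :=
    exists_extreme_pair (ht i) (ht j) (hp i).1.2 (hp j).1.2
  rw [← one i hi.1, ← one j hj.1] at hM hN
  set p₁ : ι → ℝ × ℝ := Function.update (Function.update p i (1, a)) j (1, b) with hp₁
  have e₁ : p₁ i = (1, a) := by simp [hp₁, hij]
  have e₂ : p₁ j = (1, b) := by simp [hp₁]
  have e₃ : ∀ l, l ≠ i → l ≠ j → p₁ l = p l := fun l h h' => by simp [hp₁, h, h']
  have hcan : ∀ l, IsCanonicalStage (p₁ l) := by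
    intro l
    by_cases hli : l = i
    · subst hli
      rw [e₁]
      exact ⟨⟨by simp, ha⟩, by simp⟩
    by_cases hlj : l = j
    · subst hlj
      rw [e₂]
      exact ⟨⟨by simp, hb⟩, by simp⟩
    rw [e₃ l hli hlj]
    exact hp l
  have hcard : #{l | 0 < (p₁ l).2 ∧ (p₁ l).2 < 1} < #{l | 0 < (p l).2 ∧ (p l).2 < 1} := by
    apply card_lt_card
    rw [ssubset_iff_of_subset]
    · rcases hab with h | h
      · exact ⟨i, by simpa using hi, by simpa [e₁] using h⟩
      · exact ⟨j, by simpa using hj, by simpa [e₂] using h⟩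
    · intro l hl
      simp only [mem_filter, mem_univ, true_and] at hl ⊢
      by_cases hli : l = i
      · exact hli ▸ hi
      by_cases hlj : l = j
      · exact hlj ▸ hj
      rwa [e₃ l hli hlj] at hl
  have hrest : ∀ F : ι → ℝ × ℝ → ℝ, ∏ l ∈ (univ.erase i).erase j, F l (p₁ l) =
      ∏ l ∈ (univ.erase i).erase j, F l (p l) := by
    intro F
    refine prod_congr rfl fun l hl => ?_
    simp only [mem_erase, mem_univ, and_true] at hl
    rw [e₃ l hl.2 hl.1]
  obtain ⟨p', h1, h2, h3, h4⟩ := ih _ hcard p₁ hcan rfl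
  refine ⟨p', h1, h2, h3.trans ?_, h4.trans ?_⟩
  · rw [prod_eq_mul_mul_prod_erase _ hij, prod_eq_mul_mul_prod_erase _ hij,
      hrest fun l => Mval (t l), e₁, e₂, hM]
  · rw [prod_eq_mul_mul_prod_erase _ hij, prod_eq_mul_mul_prod_erase _ hij,
      hrest fun l => Nval (t l), e₁, e₂]
    refine mul_le_mul_of_nonneg_right hN (prod_nonneg fun l _ => ?_)
    exact Nval_nonneg (ht l).2.1 ((ht l).1.le.trans (ht l).2.2) (hp l).1

/-- Every Equal Opportunity policy with positive recall is weakly Pareto dominated by an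
Equal Opportunity policy satisfying `(1 − π'^i_{X1})·π'^i_{X0} = 0` everywhere and such that
for each group there is at most one stage with `0 < π'^i_{X0} < 1`. -/
theorem stmt9 {𝒳 : Type*} [Fintype 𝒳] [Nonempty 𝒳] {k : ℕ}
    (q u : 𝒳 → ℝ) (τ : 𝒳 → Fin k → ℝ × ℝ)
    (hq : ∀ x, 0 < q x) (hu : ∀ x, 0 < u x) (hτ : MinEff τ)
    (π : 𝒳 → Fin k → ℝ × ℝ) (hπ : IsPolicy π)
    (r : ℝ) (hEO : ∀ x, MX τ π x = r) (hr : 0 < r) :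
    ∃ (π' : 𝒳 → Fin k → ℝ × ℝ) (r' : ℝ), IsPolicy π' ∧ (∀ x, MX τ π' x = r') ∧
      (∀ x i, (1 - (π' x i).1) * (π' x i).2 = 0) ∧
      (∀ x i j, (0 < (π' x i).2 ∧ (π' x i).2 < 1) →
        (0 < (π' x j).2 ∧ (π' x j).2 < 1) → i = j) ∧
      r ≤ r' ∧ prec q u τ π ≤ prec q u τ π' := by
  have hN : ∀ (ρ : 𝒳 → Fin k → ℝ × ℝ), IsPolicy ρ → ∀ x i, 0 ≤ Nval (τ x i) (ρ x i) :=
    fun ρ hρ x i => Nval_nonneg (hτ x i).2.1 ((hτ x i).1.le.trans (hτ x i).2.2) (hρ x i)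
  choose p hp hpM hpN using fun x i => exists_isCanonicalStage (hτ x i) (hπ x i)
  choose π' hcan hsub hM hNle using fun x => exists_subsingleton_random (τ x) (hτ x) (p x) (hp x)
  have hπ' : IsPolicy π' := fun x i => (hcan x i).1
  have hMX : ∀ x, MX τ π' x = MX τ π x := fun x =>
    (hM x).trans (prod_congr rfl fun i _ => hpM x i)
  have hNX : ∀ x, NX τ π' x ≤ NX τ π x := fun x =>
    (hNle x).trans (prod_le_prod (fun i _ => hN p (fun x i => (hp x i).1) x i) fun i _ => hpN x i)
  refine ⟨π', r, hπ', fun x => (hMX x).trans (hEO x), fun x i => (hcan x i).2, hsub, le_rfl, ?_⟩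
  have hpos : 0 < ∑ x, q x * MX τ π x :=
    sum_pos (fun x _ => mul_pos (hq x) (by rw [hEO]; exact hr)) univ_nonempty
  have hnn : 0 ≤ ∑ x, u x * NX τ π' x :=
    sum_nonneg fun x _ => mul_nonneg (hu x).le (prod_nonneg fun i _ => hN π' hπ' x i)
  simp only [prec, hMX]
  refine div_le_div_of_nonneg_left hpos.le (by linarith) ?_
  gcongr with x
  · exact (hu x).le
  · exact hNX x
end
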